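/- arXiv:2409.20415 — 3 statements merged into one kernel-verified Lean document; each statement's English description precedes it below -/
import Mathlib

section
/- Let τ₀ and λ be real numbers with 0 < λ ≤ τ₀ < 1. Then (1/(1 − τ₀)²) · ∫_{τ₀}^{1} ∫_{τ₀}^{1} ( 1/λ − min(λ, s₂)/(λ·s₂) − min(λ, s₁)/(λ·s₁) + min(s₁, s₂)/(s₁·s₂) ) ds₂ ds₁ = ((1 − τ₀)² + 2·λ·(1 − τ₀ + log τ₀)) / (λ·(1 − τ₀)²). -/
open MeasureTheory

/-- For `0 < lam ≤ a ≤ s ≤ b`, the integral over `t ∈ [a, b]` of the kernel at `(s, t)`. -/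
theorem integral_brownian_kernel {a b lam s : ℝ} (hlam : 0 < lam) (hle : lam ≤ a)
    (has : a ≤ s) (hsb : s ≤ b) :
    ∫ t in a..b, (1 / lam - min lam t / (lam * t) - min lam s / (lam * s)
        + min s t / (s * t)) =
      (b - a) / lam - (Real.log s - Real.log a) - (b - s) * s⁻¹ := by
  have ha : 0 < a := hlam.trans_le hle
  have hs : 0 < s := ha.trans_le has
  have hinv : IntervalIntegrable (fun t : ℝ => t⁻¹) volume a s :=
    intervalIntegral.intervalIntegrable_inv
      (fun t ht => by rw [Set.uIcc_of_le has] at ht; exact (ha.trans_le ht.1).ne')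
      continuousOn_id
  have hleft : Set.EqOn (fun t => 1 / lam - min lam t / (lam * t) - min lam s / (lam * s)
      + min s t / (s * t)) (fun t => lam⁻¹ - t⁻¹) (Set.uIcc a s) := by
    intro t ht
    rw [Set.uIcc_of_le has] at ht
    have ht0 : 0 < t := ha.trans_le ht.1
    simp only [min_eq_left (hle.trans ht.1), min_eq_left (hle.trans has), min_eq_right ht.2]
    field_simp
    ring
  have hright : Set.EqOn (fun t => 1 / lam - min lam t / (lam * t) - min lam s / (lam * s)
      + min s t / (s * t)) (fun _ => lam⁻¹ - s⁻¹) (Set.uIcc s b) := by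
    intro t ht
    rw [Set.uIcc_of_le hsb] at ht
    have ht0 : 0 < t := hs.trans_le ht.1
    simp only [min_eq_left (hle.trans (has.trans ht.1)), min_eq_left (hle.trans has),
      min_eq_left ht.1]
    field_simp
    ring
  rw [← intervalIntegral.integral_add_adjacent_intervals (b := s)
      (IntervalIntegrable.congr (fun t ht => (hleft (Set.uIoc_subset_uIcc ht)).symm)
        (intervalIntegrable_const.sub hinv))
      (IntervalIntegrable.congr (fun t ht => (hright (Set.uIoc_subset_uIcc ht)).symm)
        intervalIntegrable_const),
    intervalIntegral.integral_congr hleft, intervalIntegral.integral_congr hright,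
    intervalIntegral.integral_sub intervalIntegrable_const hinv,
    integral_inv_of_pos ha hs, Real.log_div hs.ne' ha.ne']
  simp only [intervalIntegral.integral_const, smul_eq_mul]
  ring

/-- For `0 < λ ≤ τ₀ < 1`, the Brownian-kernel double integral giving the asymptotic
null variance constant of the averaged forecast-accuracy statistic (case `λ ≤ τ₀`):
`(1/(1−τ₀)²)·∫_{τ₀}^{1}∫_{τ₀}^{1} (1/λ − min(λ,s₂)/(λ s₂) − min(λ,s₁)/(λ s₁) + min(s₁,s₂)/(s₁ s₂)) ds₂ ds₁
  = ((1−τ₀)² + 2λ(1−τ₀+log τ₀))/(λ(1−τ₀)²)`. -/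
theorem stmt3 (τ₀ lam : ℝ) (hlam : 0 < lam) (hle : lam ≤ τ₀) (hτ : τ₀ < 1) :
    (1 / (1 - τ₀) ^ 2) *
        ∫ s₁ in τ₀..1, ∫ s₂ in τ₀..1,
          (1 / lam - min lam s₂ / (lam * s₂) - min lam s₁ / (lam * s₁)
            + min s₁ s₂ / (s₁ * s₂)) =
      ((1 - τ₀) ^ 2 + 2 * lam * (1 - τ₀ + Real.log τ₀)) / (lam * (1 - τ₀) ^ 2) := by
  have hτ0 : 0 < τ₀ := hlam.trans_le hle
  have hinv : IntervalIntegrable (fun t : ℝ => t⁻¹) volume τ₀ 1 :=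
    intervalIntegral.intervalIntegrable_inv
      (fun t ht => by rw [Set.uIcc_of_le hτ.le] at ht; exact (hτ0.trans_le ht.1).ne')
      continuousOn_id
  have hinner : Set.EqOn (fun s₁ => ∫ s₂ in τ₀..1,
      (1 / lam - min lam s₂ / (lam * s₂) - min lam s₁ / (lam * s₁) + min s₁ s₂ / (s₁ * s₂)))
      (fun s₁ => ((1 - τ₀) / lam + Real.log τ₀ + 1) - Real.log s₁ - s₁⁻¹)
      (Set.uIcc τ₀ 1) := by
    intro s hs
    rw [Set.uIcc_of_le hτ.le] at hs
    have hs0 : s ≠ 0 := (hτ0.trans_le hs.1).ne'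
    simp only [integral_brownian_kernel hlam hle hs.1 hs.2]
    field_simp
    ring
  have hτ1 : 1 - τ₀ ≠ 0 := (sub_pos.2 hτ).ne'
  rw [intervalIntegral.integral_congr hinner,
    intervalIntegral.integral_sub
      (intervalIntegrable_const.sub intervalIntegral.intervalIntegrable_log') hinv,
    intervalIntegral.integral_sub intervalIntegrable_const
      intervalIntegral.intervalIntegrable_log',
    integral_inv_of_pos hτ0 one_pos, integral_log, Real.log_div one_ne_zero hτ0.ne']
  simp only [intervalIntegral.integral_const, smul_eq_mul, Real.log_one]
  field_simp
  ring
end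

section
/- Let τ₀ and λ be real numbers with 0 < τ₀ < λ ≤ 1. Then (1/(1 − τ₀)²) · ∫_{τ₀}^{1} ∫_{τ₀}^{1} ( 1/λ − min(λ, s₂)/(λ·s₂) − min(λ, s₁)/(λ·s₁) + min(s₁, s₂)/(s₁·s₂) ) ds₂ ds₁ = (1 − τ₀² + 2·λ·((1 − τ₀)·log λ + τ₀·log τ₀)) / (λ·(1 − τ₀)²). -/
open MeasureTheory

theorem intervalIntegrable_min_div_mul {a b : ℝ} (c : ℝ) (ha : 0 < a) (hab : a ≤ b)
    (hc : 0 < c) : IntervalIntegrable (fun s => min c s / (c * s)) volume a b := by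
  refine ContinuousOn.intervalIntegrable (ContinuousOn.div (by fun_prop) (by fun_prop) ?_)
  intro s hs
  rw [Set.uIcc_of_le hab] at hs
  exact (mul_pos hc (ha.trans_le hs.1)).ne'

/-- The integral of the normalised Brownian kernel `min c s / (c * s)` in one variable. -/
theorem integral_min_div_mul {a b c : ℝ} (ha : 0 < a) (hac : a ≤ c) (hcb : c ≤ b) :
    ∫ s in a..b, min c s / (c * s) = 1 - a / c + Real.log b - Real.log c := by
  have hc : 0 < c := ha.trans_le hac
  have hb : 0 < b := hc.trans_le hcb
  rw [← intervalIntegral.integral_add_adjacent_intervals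
    (intervalIntegrable_min_div_mul c ha hac hc) (intervalIntegrable_min_div_mul c hc hcb hc)]
  have h₁ : ∫ s in a..c, min c s / (c * s) = ∫ _ in a..c, 1 / c := by
    refine intervalIntegral.integral_congr fun s hs => ?_
    rw [Set.uIcc_of_le hac] at hs
    have hs0 : s ≠ 0 := (ha.trans_le hs.1).ne'
    simp only [min_eq_right hs.2]
    field_simp
  have h₂ : ∫ s in c..b, min c s / (c * s) = ∫ s in c..b, 1 / s := by
    refine intervalIntegral.integral_congr fun s hs => ?_
    rw [Set.uIcc_of_le hcb] at hs
    have hs0 : s ≠ 0 := (hc.trans_le hs.1).ne'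
    simp only [min_eq_left hs.1]
    field_simp
  rw [h₁, h₂, intervalIntegral.integral_const, integral_one_div_of_pos hc hb,
    Real.log_div hb.ne' hc.ne', smul_eq_mul]
  field_simp
  ring

/-- For `0 < τ₀ < λ ≤ 1`, the Brownian-kernel double integral giving the asymptotic
null variance constant of the averaged forecast-accuracy statistic (case `λ > τ₀`):
`(1/(1−τ₀)²)·∫_{τ₀}^{1}∫_{τ₀}^{1} (1/λ − min(λ,s₂)/(λ s₂) − min(λ,s₁)/(λ s₁) + min(s₁,s₂)/(s₁ s₂)) ds₂ ds₁
  = (1 − τ₀² + 2λ((1−τ₀)·log λ + τ₀·log τ₀))/(λ(1−τ₀)²)`. -/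
theorem stmt4 (τ₀ lam : ℝ) (hτ0 : 0 < τ₀) (hlt : τ₀ < lam) (hlam : lam ≤ 1) :
    (1 / (1 - τ₀) ^ 2) *
        ∫ s₁ in τ₀..1, ∫ s₂ in τ₀..1,
          (1 / lam - min lam s₂ / (lam * s₂) - min lam s₁ / (lam * s₁)
            + min s₁ s₂ / (s₁ * s₂)) =
      (1 - τ₀ ^ 2 + 2 * lam * ((1 - τ₀) * Real.log lam + τ₀ * Real.log τ₀)) /
        (lam * (1 - τ₀) ^ 2) := by
  have h1 : τ₀ < 1 := hlt.trans_le hlam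
  have hl : 0 < lam := hτ0.trans hlt
  have hn : 1 - τ₀ ≠ 0 := (sub_pos.2 h1).ne'
  have hmin := intervalIntegrable_min_div_mul lam hτ0 h1.le hl
  have hinner : ∀ s₁ ∈ Set.uIcc τ₀ 1,
      ∫ s₂ in τ₀..1, (1 / lam - min lam s₂ / (lam * s₂) - min lam s₁ / (lam * s₁)
        + min s₁ s₂ / (s₁ * s₂)) =
      (((1 - τ₀) / lam - (1 - τ₀ / lam - Real.log lam) + 1)
        - (1 - τ₀) * (min lam s₁ / (lam * s₁))) - τ₀ * (1 / s₁) - Real.log s₁ := by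
    intro s₁ hs
    rw [Set.uIcc_of_le h1.le] at hs
    rw [intervalIntegral.integral_add ((intervalIntegrable_const.sub hmin).sub
        intervalIntegrable_const)
        (intervalIntegrable_min_div_mul s₁ hτ0 h1.le (hτ0.trans_le hs.1)),
      intervalIntegral.integral_sub (intervalIntegrable_const.sub hmin)
        intervalIntegrable_const,
      intervalIntegral.integral_sub intervalIntegrable_const hmin,
      integral_min_div_mul hτ0 hlt.le hlam, integral_min_div_mul hτ0 hs.1 hs.2,
      intervalIntegral.integral_const, intervalIntegral.integral_const, Real.log_one,
      smul_eq_mul, smul_eq_mul]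
    ring
  have hinv : IntervalIntegrable (fun s : ℝ => 1 / s) volume τ₀ 1 := by
    refine intervalIntegral.intervalIntegrable_one_div (fun s hs => ?_) continuousOn_id
    rw [Set.uIcc_of_le h1.le] at hs
    exact (hτ0.trans_le hs.1).ne'
  rw [intervalIntegral.integral_congr hinner,
    intervalIntegral.integral_sub ((intervalIntegrable_const.sub (hmin.const_mul _)).sub
      (hinv.const_mul _)) intervalIntegral.intervalIntegrable_log',
    intervalIntegral.integral_sub (intervalIntegrable_const.sub (hmin.const_mul _))
      (hinv.const_mul _),
    intervalIntegral.integral_sub intervalIntegrable_const (hmin.const_mul _),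
    intervalIntegral.integral_const_mul, intervalIntegral.integral_const_mul,
    integral_min_div_mul hτ0 hlt.le hlam, integral_one_div_of_pos hτ0 one_pos, integral_log,
    intervalIntegral.integral_const, Real.log_div one_ne_zero hτ0.ne', Real.log_one, smul_eq_mul]
  field_simp
  ring
end

section
/- Let t, N, r be positive natural numbers, let F̂ and F be t × r real matrices, Λ an N × r real matrix, E a t × N real matrix, and set X := F·Λᵀ + E. Let Δ and B be invertible r × r real matrices with B·Δ = Δ·B, and set K := N·(B⁻¹·B⁻¹·Δ). Assume the eigenvector equation F̂·Δ = (1/(N·t))·(X·Xᵀ)·F̂. Then F̂·B − F·(ΛᵀΛ)·((1/t)·FᵀF̂)·B⁻¹·K⁻¹ = (1/t)·( F·Λᵀ·Eᵀ + E·Λ·Fᵀ + E·Eᵀ )·F̂·B⁻¹·K⁻¹. -/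
open Matrix

/-- Exact expansion of the factor estimation error in the heterogeneously weak
loadings case: with `B` the diagonal loading-strength normalization (commuting with
the eigenvalue matrix `Δ`), `K = N·B⁻¹B⁻¹Δ`, and `F̂` satisfying the eigenvector
equation `F̂Δ = (1/(Nt))·XXᵀ·F̂` for `X = FΛᵀ + E`:
`F̂B − F·ΛᵀΛ·(t⁻¹FᵀF̂)·B⁻¹·K⁻¹ = (1/t)·(FΛᵀEᵀ + EΛFᵀ + EEᵀ)·F̂·B⁻¹·K⁻¹`. -/
theorem stmt9 (t N r : ℕ) (ht : 0 < t) (hN : 0 < N) (hr : 0 < r)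
    (Fh F : Matrix (Fin t) (Fin r) ℝ) (Λ : Matrix (Fin N) (Fin r) ℝ)
    (E : Matrix (Fin t) (Fin N) ℝ) (Δ B : Matrix (Fin r) (Fin r) ℝ)
    (hΔ : IsUnit Δ.det) (hB : IsUnit B.det) (hcomm : B * Δ = Δ * B)
    (K : Matrix (Fin r) (Fin r) ℝ) (hK : K = (N : ℝ) • (B⁻¹ * B⁻¹ * Δ))
    (hEig : Fh * Δ = ((1 : ℝ) / ((N : ℝ) * (t : ℝ))) •
        ((F * Λᵀ + E) * (F * Λᵀ + E)ᵀ) * Fh) :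
    Fh * B - F * (Λᵀ * Λ) * (((1 : ℝ) / (t : ℝ)) • (Fᵀ * Fh)) * B⁻¹ * K⁻¹
      = ((1 : ℝ) / (t : ℝ)) • (F * Λᵀ * Eᵀ + E * Λ * Fᵀ + E * Eᵀ) * Fh * B⁻¹ * K⁻¹ := by
  have hN' : (N : ℝ) ≠ 0 := by positivity
  have hKdet : IsUnit K.det := by
    have hBinv : IsUnit (B⁻¹).det := (isUnit_nonsing_inv_det_iff).2 hB
    rw [hK, det_smul, det_mul, det_mul]
    exact (hN'.isUnit.pow _).mul ((hBinv.mul hBinv).mul hΔ)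
  have hBKB : B * K * B = (N : ℝ) • Δ := by
    rw [hK, Matrix.mul_smul, Matrix.smul_mul, Matrix.mul_assoc B⁻¹,
      mul_nonsing_inv_cancel_left _ _ hB, Matrix.mul_assoc, ← hcomm,
      nonsing_inv_mul_cancel_left _ _ hB]
  have hFhBKB : Fh * B * K * B =
      ((1 : ℝ) / t) • ((F * Λᵀ + E) * (F * Λᵀ + E)ᵀ) * Fh := by
    rw [Matrix.mul_assoc Fh, Matrix.mul_assoc Fh, hBKB, Matrix.mul_smul, hEig,
      ← Matrix.smul_mul, smul_smul]
    congr 2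
    field_simp
  have hFhB : Fh * B =
      ((1 : ℝ) / t) • ((F * Λᵀ + E) * (F * Λᵀ + E)ᵀ) * Fh * B⁻¹ * K⁻¹ := by
    rw [← hFhBKB, mul_nonsing_inv_cancel_right _ _ hB,
      mul_nonsing_inv_cancel_right _ _ hKdet]
  rw [hFhB, ← Matrix.sub_mul, ← Matrix.sub_mul]
  congr 2
  simp only [transpose_add, transpose_mul, transpose_transpose, Matrix.add_mul,
    Matrix.mul_add, Matrix.smul_mul, Matrix.mul_smul, smul_add, Matrix.mul_assoc]
  abel
end
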